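/- For all x, y, z ∈ ℝⁿ one has ρ(y,x) ≤ θ·ρ(x,y) and ρ(x,y) ≤ θ²·(ρ(x,z) + ρ(z,y)). Consequently, the symmetrization ρ̄(x,y) := (ρ(x,y) + ρ(y,x))/2 satisfies (1/2)·ρ(x,y) ≤ ρ̄(x,y) ≤ ((1+θ)/2)·ρ(x,y) for all x, y, and ρ̄ is a symmetric quasi-metric: ρ̄(x,y) = ρ̄(y,x), ρ̄(x,y) = 0 iff x = y, and ρ̄(x,y) ≤ A₀·(ρ̄(x,z) + ρ̄(z,y)) for all x, y, z with the constant A₀ = θ²(1+θ). -/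

import Mathlib

open MeasureTheory

/-- A differentiable convex function lies above its tangent hyperplanes. -/
theorem ConvexOn.inner_le_sub_of_hasGradientAt {E : Type*} [NormedAddCommGroup E]
    [InnerProductSpace ℝ E] [CompleteSpace E] {f : E → ℝ} {f' x : E}
    (hf : ConvexOn ℝ Set.univ f) (hf' : HasGradientAt f f' x) (y : E) :
    inner ℝ f' (y - x) ≤ f y - f x := by
  have hline : HasDerivAt (f ∘ AffineMap.lineMap (k := ℝ) x y) (inner ℝ f' (y - x)) 0 := by
    have hx : HasFDerivAt f (InnerProductSpace.toDual ℝ E f')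
        (AffineMap.lineMap (k := ℝ) x y (0 : ℝ)) := by
      simpa using hf'.hasFDerivAt
    simpa using hx.comp_hasDerivAt (0 : ℝ) AffineMap.hasDerivAt_lineMap
  simpa [slope_def_field] using
    (hf.comp_affineMap (AffineMap.lineMap (k := ℝ) x y)).le_slope_of_hasDerivAt
      (Set.mem_univ 0) (Set.mem_univ 1) one_pos hline

/-- A differentiable strictly convex function lies strictly above its tangent hyperplanes away
from the point of tangency. -/
theorem StrictConvexOn.inner_lt_sub_of_hasGradientAt {E : Type*} [NormedAddCommGroup E]
    [InnerProductSpace ℝ E] [CompleteSpace E] {f : E → ℝ} {f' x y : E}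
    (hf : StrictConvexOn ℝ Set.univ f) (hf' : HasGradientAt f f' x) (hxy : x ≠ y) :
    inner ℝ f' (y - x) < f y - f x := by
  have hmid := hf.2 (Set.mem_univ x) (Set.mem_univ y) hxy
    (one_half_pos (α := ℝ)) one_half_pos (add_halves 1)
  have htan := hf.convexOn.inner_le_sub_of_hasGradientAt hf' ((1 / 2 : ℝ) • x + (1 / 2 : ℝ) • y)
  have hsub : (1 / 2 : ℝ) • x + (1 / 2 : ℝ) • y - x = (1 / 2 : ℝ) • (y - x) := by module
  rw [hsub, real_inner_smul_right] at htan
  simp only [smul_eq_mul] at hmid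
  linarith

/-- For the Monge–Ampère quasi-distance `ρ(x,y) = φ(y) − φ(x) − ∇φ(x)·(y−x)`
generated by a strictly convex smooth `φ`, assuming the engulfing property with constant `θ ≥ 1`,
one has `ρ(y,x) ≤ θ ρ(x,y)`, `ρ(x,y) ≤ θ² (ρ(x,z) + ρ(z,y))`, and the symmetrization
`ρ̄(x,y) = (ρ(x,y)+ρ(y,x))/2` is a symmetric quasi-metric comparable to `ρ`, with
quasi-triangle constant `A₀ = θ²(1+θ)`. -/
theorem stmt_0 (n : ℕ) (φ : EuclideanSpace ℝ (Fin n) → ℝ)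
    (hconv : StrictConvexOn ℝ Set.univ φ) (hsmooth : ContDiff ℝ (⊤ : ℕ∞) φ)
    (ρ : EuclideanSpace ℝ (Fin n) → EuclideanSpace ℝ (Fin n) → ℝ)
    (hρ : ∀ x y, ρ x y = φ y - φ x - @inner ℝ _ _ (gradient φ x) (y - x))
    (θ : ℝ) (hθ : 1 ≤ θ)
    (heng : ∀ (x y : EuclideanSpace ℝ (Fin n)) (t : ℝ), 0 < t →
      ρ y x < t → ∀ z, ρ y z < t → ρ x z < θ * t) :
    (∀ x y : EuclideanSpace ℝ (Fin n), ρ y x ≤ θ * ρ x y) ∧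
    (∀ x y z : EuclideanSpace ℝ (Fin n), ρ x y ≤ θ ^ 2 * (ρ x z + ρ z y)) ∧
    (∀ x y : EuclideanSpace ℝ (Fin n),
      (1 / 2) * ρ x y ≤ (ρ x y + ρ y x) / 2 ∧
      (ρ x y + ρ y x) / 2 ≤ ((1 + θ) / 2) * ρ x y) ∧
    (∀ x y : EuclideanSpace ℝ (Fin n), (ρ x y + ρ y x) / 2 = (ρ y x + ρ x y) / 2) ∧
    (∀ x y : EuclideanSpace ℝ (Fin n), (ρ x y + ρ y x) / 2 = 0 ↔ x = y) ∧
    (∀ x y z : EuclideanSpace ℝ (Fin n),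
      (ρ x y + ρ y x) / 2 ≤
        θ ^ 2 * (1 + θ) * ((ρ x z + ρ z x) / 2 + (ρ z y + ρ y z) / 2)) := by
  have hself : ∀ x, ρ x x = 0 := fun x => by simp [hρ]
  have hpos : ∀ x y, x ≠ y → 0 < ρ x y := fun x y hxy => by
    have hgrad := (hsmooth.differentiable (by simp) x).hasGradientAt
    have := hconv.inner_lt_sub_of_hasGradientAt hgrad hxy
    rw [hρ]
    linarith
  have hnonneg : ∀ x y, 0 ≤ ρ x y := fun x y => by
    rcases eq_or_ne x y with rfl | hxy
    · exact (hself x).ge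
    · exact (hpos x y hxy).le
  have hθ0 : 0 < θ := one_pos.trans_le hθ
  have hball : ∀ x y z m, ρ z x ≤ m → ρ z y ≤ m → ρ x y ≤ θ * m := fun x y z m hx hy => by
    refine le_of_forall_pos_lt_add fun ε hε => ?_
    have hm : 0 ≤ m := (hnonneg z x).trans hx
    have hδ : 0 < ε / θ := div_pos hε hθ0
    have := heng x z (m + ε / θ) (by linarith) (by linarith) y (by linarith)
    rwa [mul_add, mul_div_cancel₀ _ hθ0.ne'] at this
  have hsymm : ∀ x y, ρ y x ≤ θ * ρ x y := fun x y =>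
    hball y x x (ρ x y) le_rfl ((hself x).trans_le (hnonneg x y))
  have htri : ∀ x y z, ρ x y ≤ θ ^ 2 * (ρ x z + ρ z y) := fun x y z => by
    have hxz := hnonneg x z
    have hzy := hnonneg z y
    have := hball x y z (θ * (ρ x z + ρ z y))
      ((hsymm x z).trans (by gcongr; linarith)) (by nlinarith)
    linarith
  refine ⟨hsymm, htri, fun x y => ⟨?_, ?_⟩, fun x y => by rw [add_comm], fun x y => ⟨?_, ?_⟩,
    fun x y z => ?_⟩
  · linarith [hnonneg y x]
  · linarith [hsymm x y]
  · intro h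
    by_contra hxy
    linarith [hpos x y hxy, hnonneg y x]
  · rintro rfl
    simp [hself]
  · have hsum : 0 ≤ (ρ x z + ρ z x) / 2 + (ρ z y + ρ y z) / 2 := by
      linarith [hnonneg x z, hnonneg z x, hnonneg z y, hnonneg y z]
    calc (ρ x y + ρ y x) / 2
        ≤ θ ^ 2 * ((ρ x z + ρ z x) / 2 + (ρ z y + ρ y z) / 2) := by
          linarith [htri x y z, htri y x z]
      _ ≤ θ ^ 2 * (1 + θ) * ((ρ x z + ρ z x) / 2 + (ρ z y + ρ y z) / 2) := by
          gcongr
          exact le_mul_of_one_le_right (sq_nonneg θ) (by linarith)
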